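/- For every symmetric network congestion game on an extension-parallel graph, every Nash equilibrium is a subgame-perfect outcome (with respect to some order of the players). -/

import Mathlib

/-- A congestion game with `n` players on a finite resource type `R`:
each player has a finite set of actions (each action a set of resources),
and each resource has a delay function `ℕ → ℝ`. -/
structure CGame (R : Type) [DecidableEq R] [Fintype R] (n : ℕ) where
  actions : Fin n → Finset (Finset R)
  delay : R → ℕ → ℝ

namespace CGame

variable {R : Type} [DecidableEq R] [Fintype R] {n : ℕ}

/-- The congestion `x(A)_r`: number of players using resource `r` in profile `A`. -/
def congestion (_G : CGame R n) (A : Fin n → Finset R) (r : R) : ℕ :=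
  (Finset.univ.filter fun i => r ∈ A i).card

/-- The cost of player `i` in profile `A`. -/
def cost (G : CGame R n) (A : Fin n → Finset R) (i : Fin n) : ℝ :=
  ∑ r ∈ A i, G.delay r (G.congestion A r)

/-- `A` is an outcome: each player plays one of his actions. -/
def IsOutcome (G : CGame R n) (A : Fin n → Finset R) : Prop :=
  ∀ i, A i ∈ G.actions i

/-- `A` is a (pure) Nash equilibrium. -/
def IsNash (G : CGame R n) (A : Fin n → Finset R) : Prop :=
  G.IsOutcome A ∧ ∀ i, ∀ B ∈ G.actions i, G.cost A i ≤ G.cost (Function.update A i B) i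

/-- The subgame induced by the first player playing `a`. -/
def subgame (G : CGame R (n + 1)) (a : Finset R) : CGame R n where
  actions := fun i => G.actions i.succ
  delay := fun r y => G.delay r (y + if r ∈ a then 1 else 0)

/-- The subgame induced by the first `m` players playing `P`. -/
def subgameMany {m k : ℕ} (G : CGame R (m + k)) (P : Fin m → Finset R) : CGame R k where
  actions := fun i => G.actions (Fin.natAdd m i)
  delay := fun r y => G.delay r (y + (Finset.univ.filter fun i : Fin m => r ∈ P i).card)

/-- `G^k`: the game on the first `min k n` players. -/
def truncate (G : CGame R n) (k : ℕ) : CGame R (min k n) where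
  actions := fun i => G.actions (Fin.castLE (min_le_right k n) i)
  delay := G.delay

/-- The game reordered so that the player in position `i` is player `σ i`. -/
def reorder (G : CGame R n) (σ : Equiv.Perm (Fin n)) : CGame R n where
  actions := fun i => G.actions (σ i)
  delay := G.delay

/-- Subgame-perfect outcomes with respect to the order `1, …, n`. -/
def IsSPO : {n : ℕ} → CGame R n → (Fin n → Finset R) → Prop
  | 0, _, _ => True
  | _ + 1, G, A =>
      A 0 ∈ G.actions 0 ∧
      ∃ f : Finset R → (Fin _ → Finset R),
        (∀ a ∈ G.actions 0, IsSPO (G.subgame a) (f a)) ∧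
        f (A 0) = Fin.tail A ∧
        ∀ a ∈ G.actions 0,
          G.cost (Fin.cons (A 0) (f (A 0))) 0 ≤ G.cost (Fin.cons a (f a)) 0

/-- `k`-lookahead outcomes with respect to the order `1, …, n`. -/
def IsKLA (k : ℕ) : {n : ℕ} → CGame R n → (Fin n → Finset R) → Prop
  | 0, _, _ => True
  | n + 1, G, A =>
      (∃ (hk : 0 < min k (n + 1)) (B : Fin (min k (n + 1)) → Finset R),
          IsSPO (G.truncate k) B ∧ B ⟨0, hk⟩ = A 0) ∧
      IsKLA k (G.subgame (A 0)) (Fin.tail A)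

/-- `A` is a subgame-perfect outcome of `G` with respect to some order of the players. -/
def IsSPOutcome (G : CGame R n) (A : Fin n → Finset R) : Prop :=
  ∃ σ : Equiv.Perm (Fin n), IsSPO (G.reorder σ) (A ∘ σ)

/-- `A` is a `k`-lookahead outcome of `G` with respect to some order of the players. -/
def IsKLO (k : ℕ) (G : CGame R n) (A : Fin n → Finset R) : Prop :=
  ∃ σ : Equiv.Perm (Fin n), IsKLA k (G.reorder σ) (A ∘ σ)

/-- The cost of player `i` when only the players in `s` play (profile restricted to `s`). -/
def costOn (G : CGame R n) (s : Finset (Fin n)) (A : Fin n → Finset R) (i : Fin n) : ℝ :=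
  ∑ r ∈ A i, G.delay r ((s.filter fun j => r ∈ A j).card)

/-- `G` is generic: in every restriction of the game to a subset of the players,
a player's cost changes whenever his own action changes. -/
def Generic (G : CGame R n) : Prop :=
  ∀ s : Finset (Fin n), ∀ A B : Fin n → Finset R,
    (∀ i ∈ s, A i ∈ G.actions i) → (∀ i ∈ s, B i ∈ G.actions i) →
    ∀ j ∈ s, A j ≠ B j → G.costOn s A j ≠ G.costOn s B j

/-- Utilitarian social cost. -/
def SC (G : CGame R n) (A : Fin n → Finset R) : ℝ :=
  ∑ i, G.cost A i

/-- Minimum social cost over all outcomes. -/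
noncomputable def optSC (G : CGame R n) : ℝ :=
  sInf {y | ∃ A, G.IsOutcome A ∧ y = G.SC A}

/-- The `k`-Lookahead Price of Anarchy. -/
noncomputable def kLPoA (G : CGame R n) (k : ℕ) : ℝ :=
  sSup {y | ∃ A, IsKLO k G A ∧ y = G.SC A / G.optSC}

/-- The Price of Anarchy. -/
noncomputable def PoA (G : CGame R n) : ℝ :=
  sSup {y | ∃ A, G.IsNash A ∧ y = G.SC A / G.optSC}

/-- Opportunity cost `O_A` of an outcome `A` in a symmetric game with action set `𝒜`. -/
noncomputable def oppCost (G : CGame R n) (𝒜 : Finset (Finset R)) (A : Fin n → Finset R) : ℝ :=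
  sInf {y | ∃ P ∈ 𝒜, y = ∑ r ∈ P, G.delay r (G.congestion A r + 1)}

/-- Worst cost (egalitarian social cost) `W_A` of an outcome `A`. -/
noncomputable def worstCost (G : CGame R n) (A : Fin n → Finset R) : ℝ :=
  sSup {y | ∃ i, y = G.cost A i}

/-- Rosenthal's potential function. -/
def potential (G : CGame R n) (A : Fin n → Finset R) : ℝ :=
  ∑ r : R, ∑ i ∈ Finset.Icc 1 (G.congestion A r), G.delay r i

end CGame
/-- Syntax trees of extension-parallel graphs: a single arc; parallel composition;
series composition of a single arc with an EP graph (arc first or arc last). -/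
inductive EPTree : Type
  | edge : EPTree
  | parallel : EPTree → EPTree → EPTree
  | extHead : EPTree → EPTree
  | extTail : EPTree → EPTree

namespace EPTree

/-- The arcs of an extension-parallel graph. -/
def Arc : EPTree → Type
  | edge => Unit
  | parallel t₁ t₂ => t₁.Arc ⊕ t₂.Arc
  | extHead t => Unit ⊕ t.Arc
  | extTail t => t.Arc ⊕ Unit

def arcDecEq : (t : EPTree) → DecidableEq t.Arc
  | edge => inferInstanceAs (DecidableEq Unit)
  | parallel t₁ t₂ =>
      letI := t₁.arcDecEq; letI := t₂.arcDecEq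
      inferInstanceAs (DecidableEq (t₁.Arc ⊕ t₂.Arc))
  | extHead t =>
      letI := t.arcDecEq
      inferInstanceAs (DecidableEq (Unit ⊕ t.Arc))
  | extTail t =>
      letI := t.arcDecEq
      inferInstanceAs (DecidableEq (t.Arc ⊕ Unit))

instance (t : EPTree) : DecidableEq t.Arc := t.arcDecEq

def arcFintype : (t : EPTree) → Fintype t.Arc
  | edge => inferInstanceAs (Fintype Unit)
  | parallel t₁ t₂ =>
      letI := t₁.arcFintype; letI := t₂.arcFintype
      inferInstanceAs (Fintype (t₁.Arc ⊕ t₂.Arc))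
  | extHead t =>
      letI := t.arcFintype
      inferInstanceAs (Fintype (Unit ⊕ t.Arc))
  | extTail t =>
      letI := t.arcFintype
      inferInstanceAs (Fintype (t.Arc ⊕ Unit))

instance (t : EPTree) : Fintype t.Arc := t.arcFintype

/-- The set of arc sets of directed `o`–`d` paths of an extension-parallel graph. -/
def paths : (t : EPTree) → Finset (Finset t.Arc)
  | edge => {(Finset.univ : Finset Unit)}
  | parallel t₁ t₂ =>
      (t₁.paths.image fun P => P.image Sum.inl) ∪ (t₂.paths.image fun P => P.image Sum.inr)
  | extHead t => t.paths.image fun P => insert (Sum.inl ()) (P.image Sum.inr)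
  | extTail t => t.paths.image fun P => insert (Sum.inr ()) (P.image Sum.inl)

end EPTree

/-- Syntax trees of series-parallel graphs: a single arc; series composition;
parallel composition. -/
inductive SPTree : Type
  | edge : SPTree
  | series : SPTree → SPTree → SPTree
  | parallel : SPTree → SPTree → SPTree

namespace SPTree

/-- The arcs of a series-parallel graph. -/
def Arc : SPTree → Type
  | edge => Unit
  | series t₁ t₂ => t₁.Arc ⊕ t₂.Arc
  | parallel t₁ t₂ => t₁.Arc ⊕ t₂.Arc

def arcDecEq : (t : SPTree) → DecidableEq t.Arc
  | edge => inferInstanceAs (DecidableEq Unit)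
  | series t₁ t₂ =>
      letI := t₁.arcDecEq; letI := t₂.arcDecEq
      inferInstanceAs (DecidableEq (t₁.Arc ⊕ t₂.Arc))
  | parallel t₁ t₂ =>
      letI := t₁.arcDecEq; letI := t₂.arcDecEq
      inferInstanceAs (DecidableEq (t₁.Arc ⊕ t₂.Arc))

instance (t : SPTree) : DecidableEq t.Arc := t.arcDecEq

def arcFintype : (t : SPTree) → Fintype t.Arc
  | edge => inferInstanceAs (Fintype Unit)
  | series t₁ t₂ =>
      letI := t₁.arcFintype; letI := t₂.arcFintype
      inferInstanceAs (Fintype (t₁.Arc ⊕ t₂.Arc))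
  | parallel t₁ t₂ =>
      letI := t₁.arcFintype; letI := t₂.arcFintype
      inferInstanceAs (Fintype (t₁.Arc ⊕ t₂.Arc))

instance (t : SPTree) : Fintype t.Arc := t.arcFintype

/-- The set of arc sets of directed `o`–`d` paths of a series-parallel graph. -/
def paths : (t : SPTree) → Finset (Finset t.Arc)
  | edge => {(Finset.univ : Finset Unit)}
  | series t₁ t₂ =>
      (t₁.paths ×ˢ t₂.paths).image fun p => p.1.image Sum.inl ∪ p.2.image Sum.inr
  | parallel t₁ t₂ =>
      (t₁.paths.image fun P => P.image Sum.inl) ∪ (t₂.paths.image fun P => P.image Sum.inr)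

/-- A series-parallel graph is extension-parallel if in every series composition one of
the two parts is a single arc. -/
def IsEP : SPTree → Prop
  | edge => True
  | series t₁ t₂ => (t₁ = edge ∧ t₂.IsEP) ∨ (t₂ = edge ∧ t₁.IsEP)
  | parallel t₁ t₂ => t₁.IsEP ∧ t₂.IsEP

end SPTree

/-- The symmetric network congestion game with `n` players on an extension-parallel
graph `t` with delay functions `d`. -/
def SNCGep (t : EPTree) (d : t.Arc → ℕ → ℝ) (n : ℕ) : CGame t.Arc n where
  actions := fun _ => t.paths
  delay := d

/-- The symmetric network congestion game with `n` players on a series-parallel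
graph `t` with delay functions `d`. -/
def SNCGsp (t : SPTree) (d : t.Arc → ℕ → ℝ) (n : ℕ) : CGame t.Arc n where
  actions := fun _ => t.paths
  delay := d

/-- Extension-parallel graphs with arcs labelled in `R`, forgetting whether an extending arc
comes first or last. -/
inductive ArcTree (R : Type) : Type
  | edge : R → ArcTree R
  | parallel : ArcTree R → ArcTree R → ArcTree R
  | ext : R → ArcTree R → ArcTree R

namespace ArcTree

variable {R : Type} [DecidableEq R]

/-- The labels of the arcs. -/
def supp : ArcTree R → Finset R
  | edge r => {r}
  | parallel t₁ t₂ => t₁.supp ∪ t₂.supp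
  | ext r t => insert r t.supp

/-- The arc sets of the paths. -/
def paths : ArcTree R → Finset (Finset R)
  | edge r => {{r}}
  | parallel t₁ t₂ => t₁.paths ∪ t₂.paths
  | ext r t => t.paths.image (insert r)

/-- Distinct arcs carry distinct labels. -/
def Simple : ArcTree R → Prop
  | edge _ => True
  | parallel t₁ t₂ => t₁.Simple ∧ t₂.Simple ∧ Disjoint t₁.supp t₂.supp
  | ext r t => t.Simple ∧ r ∉ t.supp

/-- `x` is an integral flow of value `k`. -/
def Flow : ArcTree R → ℕ → (R → ℕ) → Prop
  | edge r, k, x => x r = k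
  | parallel t₁ t₂, k, x => ∃ k₁ k₂, k₁ + k₂ = k ∧ t₁.Flow k₁ x ∧ t₂.Flow k₂ x
  | ext r t, k, x => x r = k ∧ t.Flow k x

lemma subset_supp {t : ArcTree R} {P : Finset R} (hP : P ∈ t.paths) : P ⊆ t.supp := by
  induction t generalizing P with
  | edge r => simp_all [paths, supp]
  | parallel t₁ t₂ ih₁ ih₂ =>
    simp only [paths, Finset.mem_union] at hP
    rcases hP with h | h
    · exact (ih₁ h).trans Finset.subset_union_left
    · exact (ih₂ h).trans Finset.subset_union_right
  | ext r t ih =>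
    simp only [paths, Finset.mem_image] at hP
    obtain ⟨P, hP, rfl⟩ := hP
    exact Finset.insert_subset_insert _ (ih hP)

/-- Every path has an arc that lies on no other path. -/
lemma exists_private_arc {t : ArcTree R} (ht : t.Simple) {P : Finset R} (hP : P ∈ t.paths) :
    ∃ r ∈ P, ∀ Q ∈ t.paths, r ∈ Q → Q = P := by
  induction t generalizing P with
  | edge r => simp_all [paths]
  | parallel t₁ t₂ ih₁ ih₂ =>
    obtain ⟨h₁, h₂, hd⟩ := ht
    simp only [paths, Finset.mem_union] at hP ⊢
    rcases hP with h | h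
    · obtain ⟨r, hr, H⟩ := ih₁ h₁ h
      refine ⟨r, hr, fun Q hQ hrQ => hQ.elim (fun hQ => H Q hQ hrQ) fun hQ => ?_⟩
      exact (Finset.disjoint_left.1 hd (subset_supp h hr) (subset_supp hQ hrQ)).elim
    · obtain ⟨r, hr, H⟩ := ih₂ h₂ h
      refine ⟨r, hr, fun Q hQ hrQ => hQ.elim (fun hQ => ?_) fun hQ => H Q hQ hrQ⟩
      exact (Finset.disjoint_left.1 hd (subset_supp hQ hrQ) (subset_supp h hr)).elim
  | ext r t ih =>
    simp only [paths, Finset.mem_image] at hP ⊢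
    obtain ⟨P, hP, rfl⟩ := hP
    obtain ⟨s, hs, H⟩ := ih ht.1 hP
    refine ⟨s, Finset.mem_insert_of_mem hs, ?_⟩
    rintro _ ⟨Q, hQ, rfl⟩ hsQ
    rcases Finset.mem_insert.1 hsQ with rfl | hsQ
    · exact (ht.2 (subset_supp hP hs)).elim
    · rw [H Q hQ hsQ]

lemma paths_nonempty (t : ArcTree R) : t.paths.Nonempty := by
  induction t with
  | edge r => simp [paths]
  | parallel t₁ t₂ ih₁ ih₂ => exact ih₁.mono Finset.subset_union_left
  | ext r t ih => exact ih.image _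

lemma Flow.congr {t : ArcTree R} {k : ℕ} {x y : R → ℕ} (hx : t.Flow k x)
    (h : ∀ r ∈ t.supp, x r = y r) : t.Flow k y := by
  induction t generalizing k with
  | edge r => simpa [Flow, ← h r (by simp [supp])] using hx
  | parallel t₁ t₂ ih₁ ih₂ =>
    obtain ⟨k₁, k₂, hk, h₁, h₂⟩ := hx
    exact ⟨k₁, k₂, hk, ih₁ h₁ fun r hr => h r (Finset.mem_union_left _ hr),
      ih₂ h₂ fun r hr => h r (Finset.mem_union_right _ hr)⟩
  | ext r t ih =>
    exact ⟨(h r (Finset.mem_insert_self _ _)).symm.trans hx.1,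
      ih hx.2 fun r hr => h r (Finset.mem_insert_of_mem hr)⟩

omit [DecidableEq R] in
lemma flow_zero (t : ArcTree R) : t.Flow 0 fun _ => 0 := by
  induction t with
  | edge r => rfl
  | parallel t₁ t₂ ih₁ ih₂ => exact ⟨0, 0, rfl, ih₁, ih₂⟩
  | ext r t ih => exact ⟨rfl, ih⟩

lemma Flow.le {t : ArcTree R} {k : ℕ} {x : R → ℕ} (hx : t.Flow k x) {r : R}
    (hr : r ∈ t.supp) : x r ≤ k := by
  induction t generalizing k with
  | edge s => simp only [supp, Finset.mem_singleton] at hr; subst hr; exact Nat.le_of_eq hx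
  | parallel t₁ t₂ ih₁ ih₂ =>
    obtain ⟨k₁, k₂, hk, h₁, h₂⟩ := hx
    rcases Finset.mem_union.1 hr with hr | hr
    · have := ih₁ h₁ hr; omega
    · have := ih₂ h₂ hr; omega
  | ext s t ih =>
    rcases Finset.mem_insert.1 hr with rfl | hr
    · exact hx.1.le
    · exact ih hx.2 hr

lemma Flow.pos {t : ArcTree R} (ht : t.Simple) {k : ℕ} {x : R → ℕ} (hx : t.Flow k x)
    {P : Finset R} (hP : P ∈ t.paths) (h : ∀ r ∈ P, 1 ≤ x r) : 1 ≤ k := by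
  obtain ⟨r, hr, -⟩ := exists_private_arc ht hP
  exact (h r hr).trans (hx.le (subset_supp hP hr))

/-- The loads of a flow `z` together with one more unit on the path `a`. -/
def addPath (z : R → ℕ) (a : Finset R) (r : R) : ℕ := z r + if r ∈ a then 1 else 0

lemma eq_addPath_of_disjoint {t₁ t₂ : ArcTree R} (hd : Disjoint t₁.supp t₂.supp) {a : Finset R}
    (ha : a ∈ t₁.paths) (z : R → ℕ) : ∀ r ∈ t₂.supp, z r = addPath z a r := by
  intro r hr
  rw [addPath, if_neg fun h => Finset.disjoint_left.1 hd (subset_supp ha h) hr, add_zero]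

lemma addPath_insert {t : ArcTree R} {r : R} (hr : r ∉ t.supp) (z : R → ℕ) (a : Finset R) :
    ∀ s ∈ t.supp, addPath z (insert r a) s = addPath z a s := by
  intro s hs
  have : s ≠ r := by rintro rfl; exact hr hs
  simp [addPath, this]

lemma Flow.add_path {t : ArcTree R} (ht : t.Simple) {k : ℕ} {x : R → ℕ} (hx : t.Flow k x)
    {P : Finset R} (hP : P ∈ t.paths) : t.Flow (k + 1) (addPath x P) := by
  induction t generalizing k P with
  | edge r =>
    simp only [paths, Finset.mem_singleton] at hP
    subst hP
    simpa [Flow, addPath] using hx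
  | parallel t₁ t₂ ih₁ ih₂ =>
    obtain ⟨h₁, h₂, hd⟩ := ht
    obtain ⟨k₁, k₂, rfl, hx₁, hx₂⟩ := hx
    rcases Finset.mem_union.1 hP with hP | hP
    · exact ⟨k₁ + 1, k₂, by omega, ih₁ h₁ hx₁ hP, hx₂.congr (eq_addPath_of_disjoint hd hP x)⟩
    · exact ⟨k₁, k₂ + 1, by omega, hx₁.congr (eq_addPath_of_disjoint hd.symm hP x), ih₂ h₂ hx₂ hP⟩
  | ext r t ih =>
    obtain ⟨P, hP', rfl⟩ := Finset.mem_image.1 hP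
    exact ⟨by simp [addPath, hx.1],
      (ih ht.1 hx.2 hP').congr fun s hs => (addPath_insert ht.2 x P s hs).symm⟩

/-- A larger flow exceeds a smaller one along a whole path. -/
lemma Flow.exists_path_lt {t : ArcTree R} {k l : ℕ} {x y : R → ℕ} (hx : t.Flow k x)
    (hy : t.Flow l y) (hkl : k < l) (h : ∀ r ∈ t.supp, x r ≤ y r) :
    ∃ P ∈ t.paths, ∀ r ∈ P, x r < y r := by
  induction t generalizing k l with
  | edge r =>
    simp only [Flow] at hx hy
    simpa [paths, hx, hy] using hkl
  | parallel t₁ t₂ ih₁ ih₂ =>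
    obtain ⟨k₁, k₂, rfl, hx₁, hx₂⟩ := hx
    obtain ⟨l₁, l₂, rfl, hy₁, hy₂⟩ := hy
    by_cases h₁ : k₁ < l₁
    · obtain ⟨P, hP, H⟩ := ih₁ hx₁ hy₁ h₁ fun r hr => h r (Finset.mem_union_left _ hr)
      exact ⟨P, Finset.mem_union_left _ hP, H⟩
    · obtain ⟨P, hP, H⟩ := ih₂ hx₂ hy₂ (by omega) fun r hr => h r (Finset.mem_union_right _ hr)
      exact ⟨P, Finset.mem_union_right _ hP, H⟩
  | ext r t ih =>
    obtain ⟨P, hP, H⟩ := ih hx.2 hy.2 hkl fun r hr => h r (Finset.mem_insert_of_mem hr)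
    refine ⟨insert r P, Finset.mem_image_of_mem _ hP, fun s hs => ?_⟩
    rcases Finset.mem_insert.1 hs with rfl | hs
    · rw [hx.1, hy.1]; exact hkl
    · exact H s hs

variable {M : Type} [AddCommGroup M]

variable {D : R → ℕ → M}

lemma sum_insert_alt {r : R} {P Q : Finset R} (hQ : r ∉ Q) (x : R → ℕ) :
    ∑ s ∈ insert r Q, D s (if s ∈ insert r P then x s else x s + 1) =
      D r (x r) + ∑ s ∈ Q, D s (if s ∈ P then x s else x s + 1) := by
  rw [Finset.sum_insert hQ, if_pos (Finset.mem_insert_self _ _)]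
  congr 1
  refine Finset.sum_congr rfl fun s hs => ?_
  have : s ≠ r := by rintro rfl; exact hQ hs
  simp [this]

variable [LinearOrder M]

/-- Under the loads `y`, no path used by the flow `z` has a cheaper alternative. -/
def Stable (t : ArcTree R) (D : R → ℕ → M) (z y : R → ℕ) : Prop :=
  ∀ P ∈ t.paths, ∀ Q ∈ t.paths, (∀ r ∈ P, 1 ≤ z r) →
    ∑ r ∈ P, D r (y r) ≤ ∑ r ∈ Q, D r (if r ∈ P then y r else y r + 1)

/-- Under the loads `x`, all alternatives to a used path are strictly more expensive. -/
def StrictlyStable (t : ArcTree R) (D : R → ℕ → M) (x : R → ℕ) : Prop :=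
  ∀ P ∈ t.paths, ∀ Q ∈ t.paths, P ≠ Q → (∀ r ∈ P, 1 ≤ x r) →
    ∑ r ∈ P, D r (x r) < ∑ r ∈ Q, D r (if r ∈ P then x r else x r + 1)

lemma Stable.left {t₁ t₂ : ArcTree R} {z y : R → ℕ} (h : (parallel t₁ t₂).Stable D z y) :
    t₁.Stable D z y :=
  fun P hP Q hQ => h P (Finset.mem_union_left _ hP) Q (Finset.mem_union_left _ hQ)

lemma Stable.right {t₁ t₂ : ArcTree R} {z y : R → ℕ} (h : (parallel t₁ t₂).Stable D z y) :
    t₂.Stable D z y :=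
  fun P hP Q hQ => h P (Finset.mem_union_right _ hP) Q (Finset.mem_union_right _ hQ)

lemma StrictlyStable.left {t₁ t₂ : ArcTree R} {x : R → ℕ}
    (h : (parallel t₁ t₂).StrictlyStable D x) : t₁.StrictlyStable D x :=
  fun P hP Q hQ => h P (Finset.mem_union_left _ hP) Q (Finset.mem_union_left _ hQ)

lemma StrictlyStable.right {t₁ t₂ : ArcTree R} {x : R → ℕ}
    (h : (parallel t₁ t₂).StrictlyStable D x) : t₂.StrictlyStable D x :=
  fun P hP Q hQ => h P (Finset.mem_union_right _ hP) Q (Finset.mem_union_right _ hQ)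

lemma paths_parallel_comm {t₁ t₂ : ArcTree R} :
    (parallel t₁ t₂).paths = (parallel t₂ t₁).paths := Finset.union_comm _ _

lemma Stable.swap {t₁ t₂ : ArcTree R} {z y : R → ℕ} (h : (parallel t₁ t₂).Stable D z y) :
    (parallel t₂ t₁).Stable D z y := by
  rwa [Stable, paths_parallel_comm]

lemma StrictlyStable.swap {t₁ t₂ : ArcTree R} {x : R → ℕ}
    (h : (parallel t₁ t₂).StrictlyStable D x) : (parallel t₂ t₁).StrictlyStable D x := by
  rwa [StrictlyStable, paths_parallel_comm]

lemma Stable.of_eq {t : ArcTree R} {z y : R → ℕ} (h : t.Stable D z y)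
    (hzy : ∀ r ∈ t.supp, z r = y r) : t.Stable D y y :=
  fun P hP Q hQ hPy => h P hP Q hQ fun r hr => (hPy r hr).trans (hzy r (subset_supp hP hr)).ge

lemma Stable.congr {t : ArcTree R} {z y y' : R → ℕ} (h : t.Stable D z y)
    (hy : ∀ r ∈ t.supp, y r = y' r) : t.Stable D z y' := by
  intro P hP Q hQ hPz
  refine (Finset.sum_congr rfl fun r hr => ?_).symm.trans_le
    ((h P hP Q hQ hPz).trans_eq (Finset.sum_congr rfl fun r hr => ?_))
  · rw [hy r (subset_supp hP hr)]
  · rw [hy r (subset_supp hQ hr)]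

variable [IsOrderedAddMonoid M]

lemma Stable.of_ext {r : R} {t : ArcTree R} (ht : (ext r t).Simple) {k : ℕ} {z y : R → ℕ}
    (hz : (ext r t).Flow k z) (h : (ext r t).Stable D z y) : t.Stable D z y := by
  intro P hP Q hQ hPz
  have hk := hz.2.pos ht.1 hP hPz
  have := h _ (Finset.mem_image_of_mem _ hP) _ (Finset.mem_image_of_mem _ hQ) fun s hs => by
    rcases Finset.mem_insert.1 hs with rfl | hs
    · rw [hz.1]; exact hk
    · exact hPz s hs
  rwa [sum_insert_alt fun h => ht.2 (subset_supp hQ h),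
    Finset.sum_insert fun h => ht.2 (subset_supp hP h), add_le_add_iff_left] at this

lemma StrictlyStable.of_ext {r : R} {t : ArcTree R} (ht : (ext r t).Simple) {k : ℕ} {x : R → ℕ}
    (hx : (ext r t).Flow k x) (h : (ext r t).StrictlyStable D x) : t.StrictlyStable D x := by
  intro P hP Q hQ hne hPx
  have hk := hx.2.pos ht.1 hP hPx
  have hrP : r ∉ P := fun h => ht.2 (subset_supp hP h)
  have hrQ : r ∉ Q := fun h => ht.2 (subset_supp hQ h)
  have := h _ (Finset.mem_image_of_mem _ hP) _ (Finset.mem_image_of_mem _ hQ)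
    (fun h => hne (by rw [← Finset.erase_insert hrP, h, Finset.erase_insert hrQ])) fun s hs => by
      rcases Finset.mem_insert.1 hs with rfl | hs
      · rw [hx.1]; exact hk
      · exact hPx s hs
  rwa [sum_insert_alt hrQ, Finset.sum_insert hrP, add_lt_add_iff_left] at this

/-- A path on which `y` exceeds `x` and a path on which `x` exceeds `y` cannot coexist. -/
lemma StrictlyStable.not_cross (hD : ∀ r, Monotone (D r)) {t : ArcTree R} {x z y : R → ℕ}
    (hx : t.StrictlyStable D x) (hy : t.Stable D z y) {P Q : Finset R} (hP : P ∈ t.paths)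
    (hQ : Q ∈ t.paths) (hne : Q ≠ P) (hPz : ∀ r ∈ P, 1 ≤ z r) (hPxy : ∀ r ∈ P, x r < y r)
    (hQxy : ∀ r ∈ Q, y r < x r) : False := by
  have h₁ := hy P hP Q hQ hPz
  have h₂ := hx Q hQ P hP hne fun r hr => by have := hQxy r hr; omega
  have h₃ : ∑ r ∈ Q, D r (if r ∈ P then y r else y r + 1) ≤ ∑ r ∈ Q, D r (x r) :=
    Finset.sum_le_sum fun r hr => hD r (by have := hQxy r hr; split_ifs <;> omega)
  have h₄ : ∑ r ∈ P, D r (if r ∈ Q then x r else x r + 1) ≤ ∑ r ∈ P, D r (y r) :=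
    Finset.sum_le_sum fun r hr => hD r (by have := hPxy r hr; split_ifs <;> omega)
  exact absurd (h₁.trans_lt (h₃.trans_lt (h₂.trans_le h₄))) (lt_irrefl _)

lemma ne_of_disjoint_supp {t₁ t₂ : ArcTree R} (h₁ : t₁.Simple)
    (hd : Disjoint t₁.supp t₂.supp) {P Q : Finset R} (hP : P ∈ t₁.paths) (hQ : Q ∈ t₂.paths) :
    P ≠ Q := by
  rintro rfl
  obtain ⟨r, hr, -⟩ := exists_private_arc h₁ hP
  exact Finset.disjoint_left.1 hd (subset_supp hP hr) (subset_supp hQ hr)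

/-- Stable flows depend monotonically on their value. -/
lemma StrictlyStable.monotone (hD : ∀ r, Monotone (D r)) {t : ArcTree R} (ht : t.Simple)
    {k l : ℕ} {x y : R → ℕ} (hxf : t.Flow k x) (hyf : t.Flow l y) (hx : t.StrictlyStable D x)
    (hy : t.Stable D y y) :
    (l ≤ k → ∀ r ∈ t.supp, y r ≤ x r) ∧ (k ≤ l → ∀ r ∈ t.supp, x r ≤ y r) := by
  induction t generalizing k l with
  | edge r => simp only [Flow] at hxf hyf; simp [supp, hxf, hyf]
  | parallel t₁ t₂ ih₁ ih₂ =>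
    obtain ⟨h₁, h₂, hd⟩ := ht
    obtain ⟨k₁, k₂, rfl, hxf₁, hxf₂⟩ := hxf
    obtain ⟨l₁, l₂, rfl, hyf₁, hyf₂⟩ := hyf
    have i₁ := ih₁ h₁ hxf₁ hyf₁ hx.left hy.left
    have i₂ := ih₂ h₂ hxf₂ hyf₂ hx.right hy.right
    have c₁ : ¬ (k₁ < l₁ ∧ l₂ < k₂) := by
      rintro ⟨a₁, a₂⟩
      obtain ⟨P, hP, hPl⟩ := hxf₁.exists_path_lt hyf₁ a₁ (i₁.2 a₁.le)
      obtain ⟨Q, hQ, hQl⟩ := hyf₂.exists_path_lt hxf₂ a₂ (i₂.1 a₂.le)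
      exact hx.not_cross hD hy (Finset.mem_union_left _ hP) (Finset.mem_union_right _ hQ)
        (ne_of_disjoint_supp h₁ hd hP hQ).symm (fun r hr => by have := hPl r hr; omega) hPl hQl
    have c₂ : ¬ (l₁ < k₁ ∧ k₂ < l₂) := by
      rintro ⟨a₁, a₂⟩
      obtain ⟨P, hP, hPl⟩ := hxf₂.exists_path_lt hyf₂ a₂ (i₂.2 a₂.le)
      obtain ⟨Q, hQ, hQl⟩ := hyf₁.exists_path_lt hxf₁ a₁ (i₁.1 a₁.le)
      exact hx.not_cross hD hy (Finset.mem_union_right _ hP) (Finset.mem_union_left _ hQ)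
        (ne_of_disjoint_supp h₁ hd hQ hP) (fun r hr => by have := hPl r hr; omega) hPl hQl
    refine ⟨fun h r hr => ?_, fun h r hr => ?_⟩
    · rcases Finset.mem_union.1 hr with hr | hr
      · exact i₁.1 (by omega) r hr
      · exact i₂.1 (by omega) r hr
    · rcases Finset.mem_union.1 hr with hr | hr
      · exact i₁.2 (by omega) r hr
      · exact i₂.2 (by omega) r hr
  | ext r t ih =>
    have i := ih ht.1 hxf.2 hyf.2 (hx.of_ext ht hxf) (hy.of_ext ht hyf)
    refine ⟨fun h s hs => ?_, fun h s hs => ?_⟩ <;> rcases Finset.mem_insert.1 hs with rfl | hs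
    · rw [hxf.1, hyf.1]; exact h
    · exact i.1 h s hs
    · rw [hxf.1, hyf.1]; exact h
    · exact i.2 h s hs

/-- If all units but the one on `a` are stable and the total value is less than that of a strictly
stable flow, then it is smaller along a whole path. -/
lemma StrictlyStable.exists_path_lt (hD : ∀ r, Monotone (D r)) {t : ArcTree R} (ht : t.Simple)
    {k l : ℕ} {x z : R → ℕ} {a : Finset R} (hxf : t.Flow k x) (hzf : t.Flow l z)
    (hx : t.StrictlyStable D x) (ha : a ∈ t.paths) (hy : t.Stable D z (addPath z a))
    (hkl : l + 1 < k) : ∃ P ∈ t.paths, ∀ r ∈ P, addPath z a r < x r := by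
  induction t generalizing k l a with
  | edge r =>
    simp only [Flow] at hxf hzf
    simp only [paths, Finset.mem_singleton] at ha
    subst ha
    simpa [paths, addPath, hxf, hzf] using hkl
  | parallel t₁ t₂ ih₁ ih₂ =>
    obtain ⟨h₁, h₂, hd⟩ := ht
    obtain ⟨k₁, k₂, rfl, hxf₁, hxf₂⟩ := hxf
    obtain ⟨l₁, l₂, rfl, hzf₁, hzf₂⟩ := hzf
    rcases Finset.mem_union.1 ha with ha | ha
    · by_cases h : l₁ + 1 < k₁
      · obtain ⟨P, hP, H⟩ := ih₁ h₁ hxf₁ hzf₁ hx.left ha hy.left h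
        exact ⟨P, Finset.mem_union_left _ hP, H⟩
      · have e := eq_addPath_of_disjoint hd ha z
        obtain ⟨P, hP, H⟩ := (hzf₂.congr e).exists_path_lt hxf₂ (by omega)
          ((hx.right.monotone hD h₂ hxf₂ (hzf₂.congr e) (hy.right.of_eq e)).1 (by omega))
        exact ⟨P, Finset.mem_union_right _ hP, H⟩
    · by_cases h : l₂ + 1 < k₂
      · obtain ⟨P, hP, H⟩ := ih₂ h₂ hxf₂ hzf₂ hx.right ha hy.right h
        exact ⟨P, Finset.mem_union_right _ hP, H⟩
      · have e := eq_addPath_of_disjoint hd.symm ha z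
        obtain ⟨P, hP, H⟩ := (hzf₁.congr e).exists_path_lt hxf₁ (by omega)
          ((hx.left.monotone hD h₁ hxf₁ (hzf₁.congr e) (hy.left.of_eq e)).1 (by omega))
        exact ⟨P, Finset.mem_union_left _ hP, H⟩
  | ext r t ih =>
    obtain ⟨a, ha', rfl⟩ := Finset.mem_image.1 ha
    have e := addPath_insert ht.2 z a
    obtain ⟨P, hP, H⟩ := ih ht.1 hxf.2 hzf.2 (hx.of_ext ht hxf) ha' ((hy.of_ext ht hzf).congr e) hkl
    refine ⟨insert r P, Finset.mem_image_of_mem _ hP, fun s hs => ?_⟩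
    rcases Finset.mem_insert.1 hs with rfl | hs
    · simp only [addPath, Finset.mem_insert_self, if_true, hzf.1, hxf.1]; exact hkl
    · rw [e s (subset_supp hP hs)]; exact H s hs

/-- The inductive step of `StrictlyStable.exists_path_le` at a parallel composition. -/
lemma StrictlyStable.exists_path_le_parallel (hD : ∀ r, Monotone (D r)) {t₁ t₂ : ArcTree R}
    (h₁ : t₁.Simple) (h₂ : t₂.Simple) (hd : Disjoint t₁.supp t₂.supp)
    {k₁ k₂ l₁ l₂ : ℕ} {x z : R → ℕ} {a : Finset R} (hxf₁ : t₁.Flow k₁ x) (hxf₂ : t₂.Flow k₂ x)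
    (hzf₁ : t₁.Flow l₁ z) (hzf₂ : t₂.Flow l₂ z)
    (hx : (parallel t₁ t₂).StrictlyStable D x) (ha : a ∈ t₁.paths)
    (hy : (parallel t₁ t₂).Stable D z (addPath z a))
    (ih : 1 ≤ k₁ → k₁ ≤ l₁ + 1 → ∃ P ∈ t₁.paths, (∀ r ∈ P, 1 ≤ x r) ∧
      ∑ r ∈ P, D r (x r) ≤ ∑ r ∈ a, D r (addPath z a r))
    (hk : 1 ≤ k₁ + k₂) (hkl : k₁ + k₂ ≤ l₁ + l₂ + 1) :
    ∃ P ∈ (parallel t₁ t₂).paths, (∀ r ∈ P, 1 ≤ x r) ∧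
      ∑ r ∈ P, D r (x r) ≤ ∑ r ∈ a, D r (addPath z a r) := by
  rcases Nat.eq_zero_or_pos k₁ with rfl | hk₁
  · obtain ⟨P, hP, H⟩ := t₂.flow_zero.exists_path_lt hxf₂ (by omega) fun _ _ => Nat.zero_le _
    refine ⟨P, Finset.mem_union_right _ hP, H, ?_⟩
    refine (hx P (Finset.mem_union_right _ hP) a (Finset.mem_union_left _ ha)
      (ne_of_disjoint_supp h₁ hd ha hP).symm H).le.trans ?_
    refine Finset.sum_le_sum fun r hr => hD r ?_
    have := hxf₁.le (subset_supp ha hr)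
    simp only [addPath, hr, if_true]
    split_ifs <;> omega
  · by_cases h : k₁ ≤ l₁ + 1
    · obtain ⟨P, hP, H⟩ := ih hk₁ h
      exact ⟨P, Finset.mem_union_left _ hP, H⟩
    · exfalso
      obtain ⟨Q, hQ, hQl⟩ := hx.left.exists_path_lt hD h₁ hxf₁ hzf₁ ha hy.left (by omega)
      have e := eq_addPath_of_disjoint hd ha z
      obtain ⟨P, hP, hPl⟩ := hxf₂.exists_path_lt (hzf₂.congr e) (by omega)
        ((hx.right.monotone hD h₂ hxf₂ (hzf₂.congr e) (hy.right.of_eq e)).2 (by omega))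
      refine hx.not_cross hD hy (Finset.mem_union_right _ hP) (Finset.mem_union_left _ hQ)
        (ne_of_disjoint_supp h₁ hd hQ hP) (fun r hr => ?_) hPl hQl
      rw [e r (subset_supp hP hr)]
      have := hPl r hr
      omega

/-- If all units but the one on `a` are stable and the total value is at least that of a strictly
stable flow, then `a` costs at least as much as some path used by the latter. -/
lemma StrictlyStable.exists_path_le (hD : ∀ r, Monotone (D r)) {t : ArcTree R} (ht : t.Simple)
    {k l : ℕ} {x z : R → ℕ} {a : Finset R} (hxf : t.Flow k x) (hzf : t.Flow l z)
    (hx : t.StrictlyStable D x) (ha : a ∈ t.paths) (hy : t.Stable D z (addPath z a))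
    (hk : 1 ≤ k) (hkl : k ≤ l + 1) :
    ∃ P ∈ t.paths, (∀ r ∈ P, 1 ≤ x r) ∧
      ∑ r ∈ P, D r (x r) ≤ ∑ r ∈ a, D r (addPath z a r) := by
  induction t generalizing k l a with
  | edge r =>
    simp only [Flow] at hxf hzf
    simp only [paths, Finset.mem_singleton] at ha
    subst ha
    simpa [paths, addPath, hxf, hzf] using ⟨hk, hD r hkl⟩
  | parallel t₁ t₂ ih₁ ih₂ =>
    obtain ⟨h₁, h₂, hd⟩ := ht
    obtain ⟨k₁, k₂, rfl, hxf₁, hxf₂⟩ := hxf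
    obtain ⟨l₁, l₂, rfl, hzf₁, hzf₂⟩ := hzf
    rcases Finset.mem_union.1 ha with ha | ha
    · exact hx.exists_path_le_parallel hD h₁ h₂ hd hxf₁ hxf₂ hzf₁ hzf₂ ha hy
        (ih₁ h₁ hxf₁ hzf₁ hx.left ha hy.left) hk hkl
    · rw [paths_parallel_comm]
      exact hx.swap.exists_path_le_parallel hD h₂ h₁ hd.symm hxf₂ hxf₁ hzf₂ hzf₁ ha hy.swap
        (ih₂ h₂ hxf₂ hzf₂ hx.right ha hy.right) (by omega) (by omega)
  | ext r t ih =>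
    obtain ⟨a, ha', rfl⟩ := Finset.mem_image.1 ha
    have e := addPath_insert ht.2 z a
    obtain ⟨P, hP, hPx, H⟩ :=
      ih ht.1 hxf.2 hzf.2 (hx.of_ext ht hxf) ha' ((hy.of_ext ht hzf).congr e) hk hkl
    refine ⟨insert r P, Finset.mem_image_of_mem _ hP, fun s hs => ?_, ?_⟩
    · rcases Finset.mem_insert.1 hs with rfl | hs
      · rw [hxf.1]; exact hk
      · exact hPx s hs
    · rw [Finset.sum_insert fun h => ht.2 (subset_supp hP h),
        Finset.sum_insert fun h => ht.2 (subset_supp ha' h)]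
      refine add_le_add (hD r ?_) (H.trans_eq (Finset.sum_congr rfl fun s hs => ?_))
      · simpa [addPath, hxf.1, hzf.1] using hkl
      · rw [e s (subset_supp ha' hs)]

end ArcTree

namespace EPTree

/-- The labelled tree of an extension-parallel graph whose arcs are labelled by `e`. -/
def label {R : Type} : (t : EPTree) → (t.Arc → R) → ArcTree R
  | edge, e => .edge (e ())
  | parallel t₁ t₂, e => .parallel (t₁.label fun r => e (Sum.inl r)) (t₂.label fun r => e (Sum.inr r))
  | extHead t, e => .ext (e (Sum.inl ())) (t.label fun r => e (Sum.inr r))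
  | extTail t, e => .ext (e (Sum.inr ())) (t.label fun r => e (Sum.inl r))

variable {R : Type} [DecidableEq R]

lemma exists_of_mem_supp_label {t : EPTree} {e : t.Arc → R} {r : R} (hr : r ∈ (t.label e).supp) :
    ∃ s, e s = r := by
  induction t with
  | edge => exact ⟨(), (Finset.mem_singleton.1 hr).symm⟩
  | parallel t₁ t₂ ih₁ ih₂ =>
    rcases Finset.mem_union.1 hr with hr | hr
    · obtain ⟨s, hs⟩ := ih₁ hr; exact ⟨_, hs⟩
    · obtain ⟨s, hs⟩ := ih₂ hr; exact ⟨_, hs⟩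
  | extHead t ih =>
    rcases Finset.mem_insert.1 hr with hr | hr
    · exact ⟨_, hr.symm⟩
    · obtain ⟨s, hs⟩ := ih hr; exact ⟨_, hs⟩
  | extTail t ih =>
    rcases Finset.mem_insert.1 hr with hr | hr
    · exact ⟨_, hr.symm⟩
    · obtain ⟨s, hs⟩ := ih hr; exact ⟨_, hs⟩

lemma simple_label {t : EPTree} {e : t.Arc → R} (he : Function.Injective e) :
    (t.label e).Simple := by
  induction t with
  | edge => trivial
  | parallel t₁ t₂ ih₁ ih₂ =>
    refine ⟨ih₁ (he.comp Sum.inl_injective), ih₂ (he.comp Sum.inr_injective), ?_⟩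
    refine Finset.disjoint_left.2 fun r hr hr' => ?_
    obtain ⟨s, hs⟩ := exists_of_mem_supp_label hr
    obtain ⟨s', hs'⟩ := exists_of_mem_supp_label hr'
    exact Sum.inl_ne_inr (he (hs.trans hs'.symm))
  | extHead t ih =>
    refine ⟨ih (he.comp Sum.inr_injective), fun hr => ?_⟩
    obtain ⟨s, hs⟩ := exists_of_mem_supp_label hr
    exact Sum.inr_ne_inl (he hs)
  | extTail t ih =>
    refine ⟨ih (he.comp Sum.inl_injective), fun hr => ?_⟩
    obtain ⟨s, hs⟩ := exists_of_mem_supp_label hr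
    exact Sum.inl_ne_inr (he hs)

lemma paths_label (t : EPTree) (e : t.Arc → R) :
    (t.label e).paths = t.paths.image (Finset.image e) := by
  induction t with
  | edge => rfl
  | parallel t₁ t₂ ih₁ ih₂ =>
    simp only [label, ArcTree.paths, ih₁, ih₂, paths, Finset.image_union, Finset.image_image]
    congr 1 <;> refine Finset.image_congr fun P _ => ?_ <;>
      exact (Finset.image_image (s := P)).symm
  | extHead t ih =>
    simp only [label, ArcTree.paths, ih, paths, Finset.image_image]
    refine Finset.image_congr fun P _ => ?_
    simp only [Function.comp]
    refine Eq.trans ?_ (Finset.image_insert e (Sum.inl ()) (P.image Sum.inr)).symm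
    exact congrArg (insert _) Finset.image_image.symm
  | extTail t ih =>
    simp only [label, ArcTree.paths, ih, paths, Finset.image_image]
    refine Finset.image_congr fun P _ => ?_
    simp only [Function.comp]
    refine Eq.trans ?_ (Finset.image_insert e (Sum.inr ()) (P.image Sum.inl)).symm
    exact congrArg (insert _) Finset.image_image.symm

lemma paths_label_id (t : EPTree) : (t.label id).paths = t.paths := by
  rw [paths_label, show Finset.image (id : t.Arc → t.Arc) = id from funext fun _ => Finset.image_id,
    Finset.image_id]

end EPTree

namespace CGame

open ArcTree Finset

variable {R : Type} [DecidableEq R] {n : ℕ}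

/-- The number of players using `r` in the profile `A`. -/
def load (A : Fin n → Finset R) (r : R) : ℕ :=
  (univ.filter fun i => r ∈ A i).card

lemma load_eq_sum (A : Fin n → Finset R) (r : R) :
    load A r = ∑ i, if r ∈ A i then 1 else 0 := card_filter _ _

lemma load_cons (a : Finset R) (B : Fin n → Finset R) :
    load (Fin.cons a B : Fin (n + 1) → Finset R) = addPath (load B) a := by
  funext r
  simp only [load_eq_sum, addPath, Fin.sum_univ_succ, Fin.cons_zero, Fin.cons_succ]
  exact add_comm _ _

lemma load_comp_perm (A : Fin n → Finset R) (σ : Equiv.Perm (Fin n)) :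
    load (A ∘ σ) = load A := by
  funext r
  simp only [load_eq_sum]
  exact Equiv.sum_comp σ fun i => if r ∈ A i then 1 else 0

lemma exists_load_update (A : Fin n → Finset R) (i : Fin n) :
    ∃ w : R → ℕ, ∀ Q, load (Function.update A i Q) = addPath w Q := by
  refine ⟨fun r => ∑ j ∈ univ.erase i, if r ∈ A j then 1 else 0, fun Q => ?_⟩
  funext r
  rw [load_eq_sum, addPath, ← sum_erase_add _ _ (mem_univ i), Function.update_self]
  congr 1
  refine sum_congr rfl fun j hj => ?_
  rw [Function.update_of_ne (ne_of_mem_erase hj)]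

lemma load_update_of_mem (A : Fin n → Finset R) (i : Fin n) {Q : Finset R} {r : R}
    (hr : r ∈ Q) :
    load (Function.update A i Q) r = if r ∈ A i then load A r else load A r + 1 := by
  obtain ⟨w, hw⟩ := exists_load_update A i
  have h := hw (A i)
  rw [Function.update_eq_self] at h
  rw [hw, h]
  simp only [addPath, hr, if_true]
  split_ifs <;> rfl

lemma flow_load {t : ArcTree R} (ht : t.Simple) (A : Fin n → Finset R)
    (hA : ∀ i, A i ∈ t.paths) : t.Flow n (load A) := by
  induction n with
  | zero => exact t.flow_zero.congr fun r _ => rfl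
  | succ n ih =>
    rw [← Fin.cons_self_tail A, load_cons]
    exact (ih (Fin.tail A) fun i => hA i.succ).add_path ht (hA 0)

lemma exists_eq_of_load_pos {t : ArcTree R} (ht : t.Simple) {A : Fin n → Finset R}
    (hA : ∀ i, A i ∈ t.paths) {P : Finset R} (hP : P ∈ t.paths) (h : ∀ r ∈ P, 1 ≤ load A r) :
    ∃ i, A i = P := by
  obtain ⟨r, hr, H⟩ := exists_private_arc ht hP
  obtain ⟨i, hi⟩ := card_pos.1 (h r hr)
  exact ⟨i, H _ (hA i) (mem_filter.1 hi).2⟩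

section Potential

variable {M : Type} [AddCommGroup M]

lemma sum_potential_addPath [Fintype R] (D : R → ℕ → M) (w : R → ℕ) (Q : Finset R) :
    ∑ r, ∑ m ∈ range (addPath w Q r), D r (m + 1) =
      ∑ r, ∑ m ∈ range (w r), D r (m + 1) + ∑ r ∈ Q, D r (addPath w Q r) := by
  rw [← Finset.univ_inter Q, ← sum_ite_mem, ← sum_add_distrib]
  refine sum_congr rfl fun r _ => ?_
  by_cases hr : r ∈ Q <;> simp [addPath, hr, sum_range_succ]

/-- Rosenthal's theorem: symmetric congestion games have Nash equilibria. -/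
lemma exists_equilibrium [LinearOrder M] [IsOrderedAddMonoid M] [Fintype R] (D : R → ℕ → M)
    {𝒜 : Finset (Finset R)}
    (h𝒜 : 𝒜.Nonempty) (n : ℕ) :
    ∃ B : Fin n → Finset R, (∀ i, B i ∈ 𝒜) ∧ ∀ i, ∀ Q ∈ 𝒜,
      ∑ r ∈ B i, D r (load B r) ≤ ∑ r ∈ Q, D r (if r ∈ B i then load B r else load B r + 1) := by
  obtain ⟨P, hP⟩ := h𝒜
  obtain ⟨B, hB, hmin⟩ := exists_min_image (Fintype.piFinset fun _ : Fin n => 𝒜)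
    (fun B => ∑ r, ∑ m ∈ range (load B r), D r (m + 1)) ⟨fun _ => P, by simpa using fun _ => hP⟩
  rw [Fintype.mem_piFinset] at hB
  refine ⟨B, hB, fun i Q hQ => ?_⟩
  obtain ⟨w, hw⟩ := exists_load_update B i
  have hBw := hw (B i)
  rw [Function.update_eq_self] at hBw
  have h := hmin (Function.update B i Q) (Fintype.mem_piFinset.2 fun j => by
    by_cases hj : j = i
    · subst hj; simpa using hQ
    · simpa [hj] using hB j)
  rw [hw, hBw, sum_potential_addPath, sum_potential_addPath, add_le_add_iff_left, ← hBw, ← hw] at h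
  exact h.trans_eq (sum_congr rfl fun r hr => by rw [load_update_of_mem B i hr])

end Potential

lemma isNash_iff {t : EPTree} {d : t.Arc → ℕ → ℝ} {A : Fin n → Finset t.Arc} :
    (SNCGep t d n).IsNash A ↔ (∀ i, A i ∈ t.paths) ∧ ∀ i, ∀ Q ∈ t.paths,
      ∑ r ∈ A i, d r (load A r) ≤ ∑ r ∈ Q, d r (if r ∈ A i then load A r else load A r + 1) := by
  refine and_congr Iff.rfl (forall_congr' fun i => forall₂_congr fun Q _ => ?_)
  have h : (SNCGep t d n).cost (Function.update A i Q) i =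
      ∑ r ∈ Q, d r (if r ∈ A i then load A r else load A r + 1) := by
    rw [cost, Function.update_self]
    exact sum_congr rfl fun r hr => congrArg (d r) (load_update_of_mem A i hr)
  rw [h]
  rfl

lemma cost_zero_cons {t : EPTree} {d : t.Arc → ℕ → ℝ} (a : Finset t.Arc)
    (B : Fin n → Finset t.Arc) :
    (SNCGep t d (n + 1)).cost (Fin.cons a B) 0 = ∑ r ∈ a, d r (addPath (load B) a r) := by
  rw [← load_cons]
  rfl

/-- Delays that break ties in favour of the loads `x`. -/
def tieBreak (d : R → ℕ → ℝ) (x : R → ℕ) (r : R) (m : ℕ) : ℝ ×ₗ ℤ :=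
  toLex (d r m, if x r < m then 1 else 0)

omit [DecidableEq R] in
lemma monotone_tieBreak {d : R → ℕ → ℝ} (hd : ∀ r, Monotone (d r)) (x : R → ℕ) (r : R) :
    Monotone (tieBreak d x r) := by
  intro m m' h
  refine Prod.Lex.toLex_mono ⟨hd r h, ?_⟩
  dsimp only
  split_ifs <;> omega

lemma sum_tieBreak (d : R → ℕ → ℝ) (x y : R → ℕ) (P : Finset R) :
    ∑ r ∈ P, tieBreak d x r (y r) =
      toLex (∑ r ∈ P, d r (y r), ∑ r ∈ P, if x r < y r then 1 else 0) := by
  induction P using Finset.induction_on with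
  | empty => rfl
  | insert r P hr ih => rw [sum_insert hr, ih, sum_insert hr, sum_insert hr]; rfl

lemma sum_le_of_sum_tieBreak_le {d : R → ℕ → ℝ} {x y y' : R → ℕ} {P Q : Finset R}
    (h : ∑ r ∈ P, tieBreak d x r (y r) ≤ ∑ r ∈ Q, tieBreak d x r (y' r)) :
    ∑ r ∈ P, d r (y r) ≤ ∑ r ∈ Q, d r (y' r) := by
  rw [sum_tieBreak, sum_tieBreak] at h
  exact Prod.Lex.monotone_fst _ _ h

/-- Breaking ties in favour of a Nash equilibrium makes it strict. -/
lemma strictlyStable_tieBreak {t : ArcTree R} (ht : t.Simple) {d : R → ℕ → ℝ}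
    {A : Fin n → Finset R} (hA : ∀ i, A i ∈ t.paths)
    (hNash : ∀ i, ∀ Q ∈ t.paths, ∑ r ∈ A i, d r (load A r) ≤
      ∑ r ∈ Q, d r (if r ∈ A i then load A r else load A r + 1)) :
    t.StrictlyStable (tieBreak d (load A)) (load A) := by
  intro P hP Q hQ hne hPx
  obtain ⟨i, rfl⟩ := exists_eq_of_load_pos ht hA hP hPx
  rw [sum_tieBreak, sum_tieBreak, Prod.Lex.toLex_lt_toLex']
  refine ⟨hNash i Q hQ, fun _ => ?_⟩
  obtain ⟨r, hr, H⟩ := exists_private_arc ht hQ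
  have hrA : r ∉ A i := fun h => hne (H _ hP h)
  simp only [lt_irrefl, if_false, sum_const_zero]
  exact sum_pos' (fun s _ => by split_ifs <;> simp) ⟨r, hr, by simp [hrA]⟩

/-- After any first move, there is an equilibrium of the induced subgame in which the first player
pays at least the minimum cost of a given equilibrium. -/
lemma exists_punishing_nash {t : EPTree} {d : t.Arc → ℕ → ℝ} (hd : ∀ r, Monotone (d r))
    {A : Fin (n + 1) → Finset t.Arc} (hA : (SNCGep t d (n + 1)).IsNash A) :
    ∃ i, ∀ a ∈ t.paths, ∃ B, ((SNCGep t d (n + 1)).subgame a).IsNash B ∧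
      (SNCGep t d (n + 1)).cost A i ≤ (SNCGep t d (n + 1)).cost (Fin.cons a B) 0 := by
  obtain ⟨hAp, hAn⟩ := isNash_iff.1 hA
  obtain ⟨i, hi⟩ := Finite.exists_min fun i => ∑ r ∈ A i, tieBreak d (load A) r (load A r)
  refine ⟨i, fun a ha => ?_⟩
  have ht : (t.label id).Simple := EPTree.simple_label Function.injective_id
  rw [← t.paths_label_id] at hAp hAn ha
  obtain ⟨B, hB, hBn⟩ := exists_equilibrium
    (fun r y => tieBreak d (load A) r (y + if r ∈ a then 1 else 0)) (t.label id).paths_nonempty n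
  refine ⟨B, ?_, ?_⟩
  · refine isNash_iff.2 ⟨t.paths_label_id ▸ hB, fun j Q hQ => ?_⟩
    exact sum_le_of_sum_tieBreak_le (hBn j Q (t.paths_label_id.symm ▸ hQ))
  · have hstable : (t.label id).Stable (tieBreak d (load A)) (load B) (addPath (load B) a) := by
      intro P hP Q hQ hPB
      obtain ⟨j, rfl⟩ := exists_eq_of_load_pos ht hB hP hPB
      refine (hBn j Q hQ).trans_eq (sum_congr rfl fun r _ => ?_)
      congr 1
      simp only [addPath]
      split_ifs <;> omega
    obtain ⟨P, hP, hPA, hle⟩ := (strictlyStable_tieBreak ht hAp hAn).exists_path_le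
      (monotone_tieBreak hd _) ht (flow_load ht A hAp) (flow_load ht B hB) ha hstable
      (by omega) le_rfl
    obtain ⟨j, rfl⟩ := exists_eq_of_load_pos ht hAp hP hPA
    rw [cost_zero_cons]
    exact sum_le_of_sum_tieBreak_le ((hi j).trans hle)

lemma IsNash.comp_perm {t : EPTree} {d : t.Arc → ℕ → ℝ} {A : Fin n → Finset t.Arc}
    (hA : (SNCGep t d n).IsNash A) (σ : Equiv.Perm (Fin n)) : (SNCGep t d n).IsNash (A ∘ σ) := by
  rw [isNash_iff] at hA ⊢
  rw [load_comp_perm]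
  exact ⟨fun i => hA.1 (σ i), fun i => hA.2 (σ i)⟩

lemma IsNash.tail {t : EPTree} {d : t.Arc → ℕ → ℝ} {A : Fin (n + 1) → Finset t.Arc}
    (hA : (SNCGep t d (n + 1)).IsNash A) :
    ((SNCGep t d (n + 1)).subgame (A 0)).IsNash (Fin.tail A) := by
  obtain ⟨hAp, hAn⟩ := isNash_iff.1 hA
  refine isNash_iff.2 ⟨fun i => hAp i.succ, fun i Q hQ => ?_⟩
  have h := hAn i.succ Q hQ
  rw [← Fin.cons_self_tail A, load_cons] at h
  refine h.trans_eq (sum_congr rfl fun r _ => congrArg (d r) ?_)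
  simp only [addPath, Fin.cons_succ]
  split_ifs <;> omega

/-- In a symmetric game on an extension-parallel graph, the players of a Nash equilibrium can be
reordered so that it becomes a subgame-perfect outcome. -/
lemma IsNash.exists_perm_isSPO {t : EPTree} {d : t.Arc → ℕ → ℝ} (hd : ∀ r, Monotone (d r))
    {A : Fin n → Finset t.Arc} (hA : (SNCGep t d n).IsNash A) :
    ∃ σ : Equiv.Perm (Fin n), IsSPO (SNCGep t d n) (A ∘ σ) := by
  classical
  induction n generalizing d with
  | zero => exact ⟨1, trivial⟩
  | succ n ih =>
    have hsub : ∀ (a : Finset t.Arc) (B : Fin n → Finset t.Arc),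
        ((SNCGep t d (n + 1)).subgame a).IsNash B →
        ∃ σ : Equiv.Perm (Fin n), IsSPO ((SNCGep t d (n + 1)).subgame a) (B ∘ σ) := fun a B hB =>
      ih (d := fun r y => d r (y + if r ∈ a then 1 else 0))
        (fun r _ _ h => hd r (Nat.add_le_add_right h _)) hB
    obtain ⟨i, hi⟩ := exists_punishing_nash hd hA
    obtain ⟨σ, hσ⟩ := hsub _ _ (hA.comp_perm (Equiv.swap 0 i)).tail
    have hf : ∀ a, ∃ C, a ∈ t.paths → IsSPO ((SNCGep t d (n + 1)).subgame a) C ∧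
        (SNCGep t d (n + 1)).cost A i ≤ (SNCGep t d (n + 1)).cost (Fin.cons a C) 0 := by
      intro a
      by_cases ha : a ∈ t.paths
      · obtain ⟨B, hB, hcost⟩ := hi a ha
        obtain ⟨τ, hτ⟩ := hsub a B hB
        refine ⟨B ∘ τ, fun _ => ⟨hτ, ?_⟩⟩
        rwa [cost_zero_cons, load_comp_perm, ← cost_zero_cons]
      · exact ⟨fun _ => ∅, fun h => (ha h).elim⟩
    choose f hf using hf
    set A' : Fin (n + 1) → Finset t.Arc := A ∘ Equiv.Perm.decomposeFin.symm (i, σ) with hA'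
    have h₀ : A' 0 = A i := by simp [hA']
    have h₁ : Fin.tail A' = Fin.tail (A ∘ Equiv.swap 0 i) ∘ σ := by
      funext j
      simp [hA', Fin.tail]
    have hcost : (SNCGep t d (n + 1)).cost (Fin.cons (A' 0) (Fin.tail A')) 0 =
        (SNCGep t d (n + 1)).cost A i := by
      rw [Fin.cons_self_tail]
      change ∑ r ∈ A' 0, d r (load A' r) = ∑ r ∈ A i, d r (load A r)
      rw [h₀, hA', load_comp_perm]
    have hspo : IsSPO ((SNCGep t d (n + 1)).subgame (A' 0)) (Fin.tail A') := by
      have : (A ∘ Equiv.swap 0 i) 0 = A' 0 := by simp [h₀]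
      rw [h₁, ← this]
      exact hσ
    refine ⟨Equiv.Perm.decomposeFin.symm (i, σ), hA.1 _,
      Function.update f (A' 0) (Fin.tail A'), fun a ha => ?_, Function.update_self .., fun a ha => ?_⟩
    · by_cases h : a = A' 0
      · subst h; rwa [Function.update_self]
      · rw [Function.update_of_ne h]; exact (hf a ha).1
    · change (SNCGep t d (n + 1)).cost (Fin.cons (A' 0) _) 0 ≤ _
      rw [Function.update_self, hcost]
      by_cases h : a = A' 0
      · subst h; rw [Function.update_self, hcost]
      · rw [Function.update_of_ne h]; exact (hf a ha).2

end CGame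

/-- For every symmetric network congestion game on an
extension-parallel graph, every Nash equilibrium is a subgame-perfect outcome
(with respect to some order of the players). -/
theorem ep_nash_is_spo (t : EPTree) (d : t.Arc → ℕ → ℝ)
    (hmono : ∀ r, Monotone (d r)) (hnonneg : ∀ r m, 0 ≤ d r m)
    (n : ℕ) (A : Fin n → Finset t.Arc)
    (hA : CGame.IsNash (SNCGep t d n) A) :
    CGame.IsSPOutcome (SNCGep t d n) A := by
  exact hA.exists_perm_isSPO hmono
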